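/- arXiv:1807.11058 — 5 statements merged into one kernel-verified Lean document; each statement's English description precedes it below -/
import Mathlib

section
/- Let A be a real 2n×2n matrix, let k₀, k₁, …, k_m ∈ ℝ, and let E be the (m+1)·2n × (m+1)·2n block companion matrix whose (j, j+1) blocks are the 2n×2n identity for j = 1, …, m, whose last block row is (k₀A, k₁A, …, k_mA), and whose other blocks are zero. Suppose that for every nonzero complex eigenvalue μ of A, every complex root λ of the polynomial equation λ^{m+1} − k_m μ λ^m − ⋯ − k₁ μ λ − k₀ μ = 0 has negative real part. Then every nonzero complex eigenvalue of E has negative real part. -/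
open Matrix

/-- If for every nonzero complex eigenvalue `μ` of `A` all roots of
`λ^{m+1} − μ ∑ⱼ kⱼ λʲ = 0` have negative real part, then every nonzero eigenvalue of the
block companion matrix `E` has negative real part. -/
theorem block_companion_hurwitz
    (n m : ℕ) (A : Matrix (Fin (2 * n)) (Fin (2 * n)) ℝ) (k : Fin (m + 1) → ℝ)
    (E : Matrix (Fin (m + 1) × Fin (2 * n)) (Fin (m + 1) × Fin (2 * n)) ℝ)
    (hE : ∀ (j j' : Fin (m + 1)) (i i' : Fin (2 * n)), E (j, i) (j', i') =
      if (j : ℕ) < m then (if (j' : ℕ) = (j : ℕ) + 1 ∧ i = i' then 1 else 0)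
      else k j' * A i i')
    (hroots : ∀ μ : ℂ,
      (μ • (1 : Matrix (Fin (2 * n)) (Fin (2 * n)) ℂ) - A.map Complex.ofReal).det = 0 →
      μ ≠ 0 →
      ∀ lam : ℂ,
        lam ^ (m + 1) - μ * ∑ j : Fin (m + 1), (k j : ℂ) * lam ^ (j : ℕ) = 0 →
        lam.re < 0) :
    ∀ lam : ℂ,
      (lam • (1 : Matrix (Fin (m + 1) × Fin (2 * n)) (Fin (m + 1) × Fin (2 * n)) ℂ) -
        E.map Complex.ofReal).det = 0 →
      lam ≠ 0 → lam.re < 0 := by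
  intro lam hdet hlam
  obtain ⟨v, hv0, hv⟩ := Matrix.exists_mulVec_eq_zero_iff.mpr hdet
  have hrow : ∀ (j : Fin (m + 1)) (i : Fin (2 * n)),
      lam * v (j, i) = ∑ j', ∑ i', (E (j, i) (j', i') : ℂ) * v (j', i') := by
    intro j i
    have h := congrFun hv (j, i)
    rw [Matrix.sub_mulVec, Matrix.smul_mulVec, Matrix.one_mulVec] at h
    simp only [Pi.sub_apply, Pi.smul_apply, smul_eq_mul, Pi.zero_apply, Matrix.mulVec,
      dotProduct, Matrix.map_apply, Fintype.sum_prod_type] at h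
    exact sub_eq_zero.mp h
  have hstep : ∀ (j : ℕ) (hj : j < m) (i : Fin (2 * n)),
      v (⟨j + 1, by omega⟩, i) = lam * v (⟨j, by omega⟩, i) := by
    intro j hj i
    rw [hrow, Finset.sum_eq_single (⟨j + 1, by omega⟩ : Fin (m + 1)),
      Finset.sum_eq_single i]
    · rw [hE]; simp [hj]
    · intro i' _ hi'
      rw [hE]; simp [hj, Ne.symm hi']
    · simp
    · intro j' _ hj'
      have : (j' : ℕ) ≠ j + 1 := fun h => hj' (Fin.ext h)
      refine Finset.sum_eq_zero fun i' _ => ?_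
      rw [hE]; simp [hj, this]
    · simp
  have hpow : ∀ (j : ℕ) (hj : j < m + 1) (i : Fin (2 * n)),
      v (⟨j, hj⟩, i) = lam ^ j * v (0, i) := by
    intro j
    induction j with
    | zero => intro hj i; simp
    | succ j ih =>
      intro hj i
      rw [hstep j (by omega) i, ih (by omega) i]; ring
  have hpow' : ∀ (j : Fin (m + 1)) (i : Fin (2 * n)),
      v (j, i) = lam ^ (j : ℕ) * v (0, i) := fun j i => hpow j j.2 i
  set w : Fin (2 * n) → ℂ := fun i => v (0, i) with hw
  have hw0 : w ≠ 0 := by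
    intro h
    apply hv0
    ext ⟨j, i⟩
    rw [hpow' j i]
    have := congrFun h i
    simp only [hw, Pi.zero_apply] at this
    simp [this]
  set p : ℂ := ∑ j : Fin (m + 1), (k j : ℂ) * lam ^ (j : ℕ) with hp
  have hlast : ∀ i, lam ^ (m + 1) * w i = p * ((A.map Complex.ofReal) *ᵥ w) i := by
    intro i
    have h := hrow (Fin.last m) i
    rw [hpow'] at h
    calc lam ^ (m + 1) * w i = lam * (lam ^ ((Fin.last m : Fin (m + 1)) : ℕ) * v (0, i)) := by
          simp only [Fin.val_last, hw]; ring
      _ = _ := h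
      _ = _ := by
        rw [hp, Finset.sum_mul]
        refine Finset.sum_congr rfl fun j _ => ?_
        simp only [Matrix.mulVec, dotProduct, Finset.mul_sum]
        refine Finset.sum_congr rfl fun i' _ => ?_
        rw [hE, hpow' j i']
        simp [hw]
        ring
  obtain ⟨i0, hi0⟩ := Function.ne_iff.mp hw0
  have hp0 : p ≠ 0 := by
    intro h
    have := hlast i0
    rw [h, zero_mul] at this
    exact mul_ne_zero (pow_ne_zero _ hlam) hi0 this
  refine hroots (lam ^ (m + 1) / p) ?_ (div_ne_zero (pow_ne_zero _ hlam) hp0) lam ?_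
  · refine Matrix.exists_mulVec_eq_zero_iff.mp ⟨w, hw0, ?_⟩
    rw [Matrix.sub_mulVec, Matrix.smul_mulVec, Matrix.one_mulVec]
    ext i
    simp only [Pi.sub_apply, Pi.smul_apply, smul_eq_mul, Pi.zero_apply]
    rw [div_mul_eq_mul_div, hlast i, mul_div_cancel_left₀ _ hp0, sub_self]
  · rw [← hp, div_mul_cancel₀ _ hp0, sub_self]
end

section
/- Let A be a real 2n×2n symmetric negative semidefinite matrix. Let q : ℝ → (ℝ²)ⁿ and θ : ℝ → ℝⁿ be continuously differentiable and suppose that for every agent i and all t ≥ 0, with hᵢ := (cos θᵢ, sin θᵢ), hᵢ⊥ := (−sin θᵢ, cos θᵢ), and uᵢ := (A q(t))ᵢ, the unicycle closed-loop dynamics hold: q̇ᵢ = ⟨hᵢ, uᵢ⟩·hᵢ and θ̇ᵢ = ⟨hᵢ⊥, uᵢ⟩. Then dist(q(t), ker A) → 0 as t → ∞. -/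
open Filter Matrix

/-- Barbalat-type lemma. -/
lemma uc_barbalat (F g g' e : ℝ → ℝ) (l : ℝ)
    (hF : ∀ t, 0 ≤ t → HasDerivAt F (g t + e t) t)
    (hg : ∀ t, 0 ≤ t → HasDerivAt g (g' t) t)
    (hb : ∃ M, ∀ t, 0 ≤ t → |g' t| ≤ M)
    (hg0 : ∀ t, 0 ≤ t → 0 ≤ g t)
    (hl : Tendsto F atTop (nhds l)) (he : Tendsto e atTop (nhds 0)) :
    Tendsto g atTop (nhds 0) := by
  obtain ⟨M, hM⟩ := hb
  have hM0 : 0 ≤ M := (abs_nonneg _).trans (hM 0 le_rfl)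
  rw [Metric.tendsto_atTop]
  intro ε hε
  set δ : ℝ := ε / (4 * (M + 1)) with hδ
  have hδ0 : 0 < δ := by positivity
  have hMδ : M * δ ≤ ε / 4 := by
    rw [hδ, ← mul_div_assoc, div_le_iff₀ (by positivity)]
    nlinarith
  obtain ⟨T1, h1⟩ := (Metric.tendsto_atTop.1 hl) (ε * δ / 8) (by positivity)
  obtain ⟨T2, h2⟩ := (Metric.tendsto_atTop.1 he) (ε / 4) (by positivity)
  refine ⟨max 0 (max T1 T2), fun t ht => ?_⟩
  have ht0 : 0 ≤ t := (le_max_left _ _).trans ht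
  have ht1 : T1 ≤ t := ((le_max_left _ _).trans (le_max_right _ _)).trans ht
  have ht2 : T2 ≤ t := ((le_max_right _ _).trans (le_max_right _ _)).trans ht
  rw [Real.dist_eq, sub_zero, abs_of_nonneg (hg0 t ht0)]
  obtain ⟨x, hx, hxe⟩ := exists_hasDerivAt_eq_slope F (fun t => g t + e t)
    (show t < t + δ by linarith)
    (fun y hy => (hF y (ht0.trans hy.1)).continuousAt.continuousWithinAt)
    (fun y hy => hF y (ht0.trans hy.1.le))
  obtain ⟨y, hy, hye⟩ := exists_hasDerivAt_eq_slope g g' hx.1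
    (fun y hy => (hg y (ht0.trans hy.1)).continuousAt.continuousWithinAt)
    (fun y hy => hg y (ht0.trans hy.1.le))
  have a1 := h1 t ht1
  have a2 := h1 (t + δ) (by linarith)
  have a3 := h2 x (by linarith [hx.1])
  have a4 := hM y (by linarith [hy.1])
  rw [Real.dist_eq, abs_lt] at a1 a2 a3
  rw [abs_le] at a4
  have hxt : 0 < x - t := by linarith [hx.1]
  have hxt' : x - t ≤ δ := by linarith [hx.2]
  rw [eq_div_iff hxt.ne'] at hye
  rw [eq_div_iff (by linarith)] at hxe
  have hgx : g t - g x ≤ ε / 4 := by nlinarith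
  have hgx2 : g x + e x ≤ ε / 4 := by
    by_contra hc
    push Not at hc
    nlinarith
  linarith

def UcBdd (f : ℝ → ℝ) : Prop := ∃ M, ∀ t, 0 ≤ t → |f t| ≤ M

lemma UcBdd.add {f g : ℝ → ℝ} (hf : UcBdd f) (hg : UcBdd g) : UcBdd (fun t => f t + g t) := by
  obtain ⟨M, hM⟩ := hf
  obtain ⟨N, hN⟩ := hg
  exact ⟨M + N, fun t ht => (abs_add_le _ _).trans (add_le_add (hM t ht) (hN t ht))⟩

lemma UcBdd.mul {f g : ℝ → ℝ} (hf : UcBdd f) (hg : UcBdd g) : UcBdd (fun t => f t * g t) := by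
  obtain ⟨M, hM⟩ := hf
  obtain ⟨N, hN⟩ := hg
  refine ⟨M * N, fun t ht => ?_⟩
  rw [abs_mul]
  exact mul_le_mul (hM t ht) (hN t ht) (abs_nonneg _) ((abs_nonneg _).trans (hM t ht))

lemma UcBdd.neg {f : ℝ → ℝ} (hf : UcBdd f) : UcBdd (fun t => -f t) := by
  obtain ⟨M, hM⟩ := hf
  exact ⟨M, fun t ht => by rw [abs_neg]; exact hM t ht⟩

lemma UcBdd.const (c : ℝ) : UcBdd (fun _ => c) := ⟨|c|, fun _ _ => le_rfl⟩

lemma UcBdd.cos (f : ℝ → ℝ) : UcBdd (fun t => Real.cos (f t)) :=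
  ⟨1, fun _ _ => Real.abs_cos_le_one _⟩

lemma UcBdd.sin (f : ℝ → ℝ) : UcBdd (fun t => Real.sin (f t)) :=
  ⟨1, fun _ _ => Real.abs_sin_le_one _⟩

lemma UcBdd.sum {ι : Type*} (s : Finset ι) {f : ι → ℝ → ℝ} (hf : ∀ i, UcBdd (f i)) :
    UcBdd (fun t => ∑ i ∈ s, f i t) := by
  choose M hM using hf
  exact ⟨∑ i ∈ s, M i, fun t ht =>
    (Finset.abs_sum_le_sum_abs _ _).trans (Finset.sum_le_sum fun i _ => hM i t ht)⟩

open scoped MatrixOrder Matrix.Norms.L2Operator in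
/-- If the quadratic form of a positive semidefinite matrix is bounded, so is `A x`. -/
lemma uc_mulVec_bdd {ι : Type*} [Fintype ι] [DecidableEq ι] (A : Matrix ι ι ℝ)
    (hsymm : A.IsSymm) (hnsd : ∀ v : ι → ℝ, v ⬝ᵥ A.mulVec v ≤ 0) (x : ℝ → ι → ℝ)
    (hx : ∃ M, ∀ t, 0 ≤ t → - (x t ⬝ᵥ A.mulVec (x t)) ≤ M) (j : ι) :
    UcBdd (fun t => A.mulVec (x t) j) := by
  have hps : (-A).PosSemidef := by
    refine Matrix.PosSemidef.of_dotProduct_mulVec_nonneg ?_ ?_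
    · show (-A)ᴴ = -A
      rw [Matrix.conjTranspose_neg, Matrix.conjTranspose_eq_transpose_of_trivial, hsymm.eq]
    · intro v
      have := hnsd v
      simp only [star_trivial, Matrix.neg_mulVec, dotProduct_neg]
      linarith
  obtain ⟨B, hB⟩ := CStarAlgebra.nonneg_iff_eq_star_mul_self.mp hps.nonneg
  rw [Matrix.star_eq_conjTranspose] at hB
  rw [Matrix.conjTranspose_eq_transpose_of_trivial] at hB
  have hA : ∀ v, A.mulVec v = -(Bᵀ.mulVec (B.mulVec v)) := by
    intro v
    rw [Matrix.mulVec_mulVec, ← hB, Matrix.neg_mulVec, neg_neg]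
  obtain ⟨M, hM⟩ := hx
  have hy : ∀ k, UcBdd (fun t => B.mulVec (x t) k) := by
    intro k
    refine ⟨M + 1, fun t ht => ?_⟩
    have h := hM t ht
    rw [hA, dotProduct_neg, neg_neg, Matrix.dotProduct_mulVec, Matrix.vecMul_transpose] at h
    have h2 : B.mulVec (x t) k * B.mulVec (x t) k ≤ B.mulVec (x t) ⬝ᵥ B.mulVec (x t) :=
      Finset.single_le_sum (f := fun k => B.mulVec (x t) k * B.mulVec (x t) k)
        (fun i _ => mul_self_nonneg _) (Finset.mem_univ k)
    rw [abs_le]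
    constructor <;> nlinarith
  have : (fun t => A.mulVec (x t) j) =
      fun t => -(∑ k, Bᵀ j k * B.mulVec (x t) k) := by
    funext t
    rw [hA]
    rfl
  rw [this]
  exact (UcBdd.sum _ fun k => (UcBdd.const _).mul (hy k)).neg

lemma uc_dist {ι : Type*} [Fintype ι] (A : Matrix ι ι ℝ) (q : ℝ → EuclideanSpace ℝ ι)
    (h : ∀ j, Tendsto (fun t => A.mulVec (q t) j) atTop (nhds 0)) :
    Tendsto (fun t => Metric.infDist (q t)
        {x : EuclideanSpace ℝ ι | A.mulVec x = 0}) atTop (nhds 0) := by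
  let T : EuclideanSpace ℝ ι →ₗ[ℝ] (ι → ℝ) :=
    A.mulVecLin ∘ₗ (WithLp.linearEquiv 2 ℝ (ι → ℝ)).toLinearMap
  have hT : ∀ x : EuclideanSpace ℝ ι, T x = A.mulVec x := fun x => rfl
  obtain ⟨S0, hS0⟩ := T.rangeRestrict.exists_rightInverse_of_surjective T.range_rangeRestrict
  obtain ⟨S, hS⟩ := LinearMap.exists_extend S0
  have hTS : ∀ x, T (S (T x)) = T x := by
    intro x
    have e1 : S (T x) = S0 (T.rangeRestrict x) := by rw [← hS]; rfl
    have e2 := congrArg Subtype.val (LinearMap.congr_fun hS0 (T.rangeRestrict x))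
    rw [e1]
    exact e2
  have hlim : Tendsto (fun t => ‖S (T (q t))‖) atTop (nhds 0) := by
    have h1 : Tendsto (fun t => T (q t)) atTop (nhds 0) := by
      rw [tendsto_pi_nhds]
      exact h
    have h2 := ((LinearMap.continuous_of_finiteDimensional S).norm.tendsto 0).comp h1
    simpa [Function.comp_def] using h2
  refine squeeze_zero (fun _ => Metric.infDist_nonneg) (fun t => ?_) hlim
  have hm : q t - S (T (q t)) ∈ {x : EuclideanSpace ℝ ι | A.mulVec x = 0} := by
    show T (q t - S (T (q t))) = 0
    rw [map_sub, hTS, sub_self]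
  refine (Metric.infDist_le_dist_of_mem hm).trans ?_
  rw [dist_eq_norm, sub_sub_cancel]

/-- Under the unicycle closed-loop dynamics
`q̇ᵢ = ⟨hᵢ, uᵢ⟩ hᵢ`, `θ̇ᵢ = ⟨hᵢ⊥, uᵢ⟩` with `uᵢ = (A q)ᵢ`, where `A` is symmetric negative
semidefinite, the configuration converges to `ker A`: `dist (q t, ker A) → 0`. -/
theorem unicycle_converges
    (n : ℕ) (A : Matrix (Fin n × Fin 2) (Fin n × Fin 2) ℝ)
    (hsymm : A.IsSymm) (hnsd : ∀ v : Fin n × Fin 2 → ℝ, v ⬝ᵥ A.mulVec v ≤ 0)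
    (q : ℝ → EuclideanSpace ℝ (Fin n × Fin 2)) (θ : ℝ → Fin n → ℝ)
    (hq : ContDiff ℝ 1 q) (hθ : ContDiff ℝ 1 θ)
    (hdyn : ∀ t : ℝ, 0 ≤ t → ∀ i : Fin n,
      HasDerivAt (fun s => q s (i, 0))
        ((Real.cos (θ t i) * A.mulVec (q t) (i, 0) +
          Real.sin (θ t i) * A.mulVec (q t) (i, 1)) * Real.cos (θ t i)) t ∧
      HasDerivAt (fun s => q s (i, 1))
        ((Real.cos (θ t i) * A.mulVec (q t) (i, 0) +
          Real.sin (θ t i) * A.mulVec (q t) (i, 1)) * Real.sin (θ t i)) t ∧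
      HasDerivAt (fun s => θ s i)
        (-Real.sin (θ t i) * A.mulVec (q t) (i, 0) +
          Real.cos (θ t i) * A.mulVec (q t) (i, 1)) t) :
    Tendsto (fun t => Metric.infDist (q t)
        {x : EuclideanSpace ℝ (Fin n × Fin 2) | A.mulVec x = 0}) atTop (nhds 0) := by
  -- abbreviations
  set c : Fin n → ℝ → ℝ := fun i t => Real.cos (θ t i) with hc
  set s : Fin n → ℝ → ℝ := fun i t => Real.sin (θ t i) with hs
  set u : Fin n × Fin 2 → ℝ → ℝ := fun j t => A.mulVec (q t) j with hu
  set v : Fin n → ℝ → ℝ := fun i t => c i t * u (i, 0) t + s i t * u (i, 1) t with hv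
  set w : Fin n → ℝ → ℝ := fun i t => -s i t * u (i, 0) t + c i t * u (i, 1) t with hw
  set p : Fin n × Fin 2 → ℝ → ℝ := fun j t => v j.1 t * (if j.2 = 0 then c j.1 t else s j.1 t)
    with hp
  have hcs : ∀ i t, s i t ^ 2 + c i t ^ 2 = 1 := fun i t => Real.sin_sq_add_cos_sq _
  have dq : ∀ j t, 0 ≤ t → HasDerivAt (fun r => q r j) (p j t) t := by
    rintro ⟨i, k⟩ t ht
    fin_cases k
    · simpa [hp] using (hdyn t ht i).1
    · simpa [hp] using (hdyn t ht i).2.1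
  have dθ : ∀ i t, 0 ≤ t → HasDerivAt (fun r => θ r i) (w i t) t :=
    fun i t ht => (hdyn t ht i).2.2
  have du : ∀ j t, 0 ≤ t → HasDerivAt (u j) (∑ k, A j k * p k t) t := by
    intro j t ht
    have := HasDerivAt.fun_sum (u := Finset.univ) (fun k _ => (dq k t ht).const_mul (A j k))
    exact this
  set u' : Fin n × Fin 2 → ℝ → ℝ := fun j t => ∑ k, A j k * p k t with hu'
  have dc : ∀ i t, 0 ≤ t → HasDerivAt (c i) (-s i t * w i t) t :=
    fun i t ht => (dθ i t ht).cos
  have ds : ∀ i t, 0 ≤ t → HasDerivAt (s i) (c i t * w i t) t :=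
    fun i t ht => (dθ i t ht).sin
  have dv : ∀ i t, 0 ≤ t → HasDerivAt (v i)
      (w i t ^ 2 + (c i t * u' (i, 0) t + s i t * u' (i, 1) t)) t := by
    intro i t ht
    have := ((dc i t ht).mul (du (i, 0) t ht)).add ((ds i t ht).mul (du (i, 1) t ht))
    refine this.congr_deriv ?_
    simp only [hw]
    ring
  have dw : ∀ i t, 0 ≤ t → HasDerivAt (w i)
      (-(w i t * v i t) + (-s i t * u' (i, 0) t + c i t * u' (i, 1) t)) t := by
    intro i t ht
    have := ((ds i t ht).neg.mul (du (i, 0) t ht)).add ((dc i t ht).mul (du (i, 1) t ht))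
    refine this.congr_deriv ?_
    simp only [hv, Pi.neg_apply]
    ring
  -- energy
  set F : ℝ → ℝ := fun t => ∑ j, q t j * u j t with hFdef
  have hF0 : ∀ t, F t ≤ 0 := fun t => hnsd (q t)
  set g : ℝ → ℝ := fun t => ∑ i, 2 * v i t ^ 2 with hg
  have hg0 : ∀ t, 0 ≤ g t := fun t => Finset.sum_nonneg fun i _ => by positivity
  have dF : ∀ t, 0 ≤ t → HasDerivAt F (g t) t := by
    intro t ht
    have := HasDerivAt.fun_sum (u := Finset.univ)
      (fun j _ => (dq j t ht).mul (du j t ht))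
    refine this.congr_deriv ?_
    have e1 : ∑ j, q t j * u' j t = ∑ j, p j t * u j t := by
      simp only [hu', hu, Matrix.mulVec, dotProduct, Finset.mul_sum]
      rw [Finset.sum_comm]
      refine Finset.sum_congr rfl fun j _ => Finset.sum_congr rfl fun k _ => ?_
      rw [← hsymm.apply j k]
      ring
    have e2 : ∑ j, p j t * u j t = ∑ i, v i t ^ 2 := by
      rw [Fintype.sum_prod_type]
      refine Finset.sum_congr rfl fun i _ => ?_
      rw [Fin.sum_univ_two]
      simp only [hp, if_true, one_ne_zero, if_false]
      simp only [hv]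
      ring
    rw [Finset.sum_add_distrib, e1, e2]
    simp only [hg, ← Finset.mul_sum]
    ring
  have hmono : MonotoneOn F (Set.Ici 0) := by
    refine monotoneOn_of_hasDerivWithinAt_nonneg (convex_Ici 0)
      (fun t ht => (dF t ht).continuousAt.continuousWithinAt)
      (f' := g) (fun t ht => ?_) (fun t _ => hg0 t)
    rw [interior_Ici] at ht
    exact (dF t (le_of_lt ht)).hasDerivWithinAt
  obtain ⟨l, hl⟩ : ∃ l, Tendsto F atTop (nhds l) := by
    have hm : Monotone (fun t => F (max t 0)) := fun a b hab =>
      hmono (Set.mem_Ici.2 (le_max_right _ _)) (Set.mem_Ici.2 (le_max_right _ _)) (max_le_max_right 0 hab)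
    refine ⟨_, (tendsto_atTop_ciSup hm ⟨0, ?_⟩).congr' ?_⟩
    · rintro _ ⟨t, rfl⟩
      exact hF0 _
    · filter_upwards [eventually_ge_atTop 0] with t ht
      rw [max_eq_left ht]
  -- boundedness
  have bu : ∀ j, UcBdd (u j) := by
    intro j
    refine uc_mulVec_bdd A hsymm hnsd (fun t => q t) ⟨-F 0, fun t ht => ?_⟩ j
    exact neg_le_neg (hmono (Set.mem_Ici.2 le_rfl) ht ht)
  have bc : ∀ i, UcBdd (c i) := fun i => UcBdd.cos _
  have bs : ∀ i, UcBdd (s i) := fun i => UcBdd.sin _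
  have bv : ∀ i, UcBdd (v i) := fun i => ((bc i).mul (bu _)).add ((bs i).mul (bu _))
  have bw : ∀ i, UcBdd (w i) := fun i => ((bs i).neg.mul (bu _)).add ((bc i).mul (bu _))
  have bp : ∀ j, UcBdd (p j) := by
    rintro ⟨i, k⟩
    fin_cases k
    · simpa [hp] using (bv i).mul (bc i)
    · simpa [hp] using (bv i).mul (bs i)
  have bu' : ∀ j, UcBdd (u' j) := fun j => UcBdd.sum _ fun k => (UcBdd.const _).mul (bp k)
  -- first application
  have lg : Tendsto g atTop (nhds 0) := by
    refine uc_barbalat F g (fun t => ∑ i, 2 * (2 * (v i t *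
      (w i t * w i t + (c i t * u' (i, 0) t + s i t * u' (i, 1) t))))) (fun _ => 0) l
      (fun t ht => by simpa using dF t ht) (fun t ht => ?_) ?_ (fun t _ => hg0 t) hl
      tendsto_const_nhds
    · have := HasDerivAt.fun_sum (u := Finset.univ)
        (fun i _ => ((dv i t ht).pow 2).const_mul 2)
      refine this.congr_deriv (Finset.sum_congr rfl fun i _ => ?_)
      push_cast
      ring
    · exact UcBdd.sum _ fun i => (UcBdd.const _).mul ((UcBdd.const _).mul ((bv i).mul
        (((bw i).mul (bw i)).add (((bc i).mul (bu' _)).add ((bs i).mul (bu' _))))))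
  have sq0 : ∀ f : ℝ → ℝ, Tendsto (fun t => f t ^ 2) atTop (nhds 0) →
      Tendsto f atTop (nhds 0) := by
    intro f hf
    rw [tendsto_zero_iff_abs_tendsto_zero]
    have := (Real.continuous_sqrt.tendsto 0).comp hf
    simpa [Function.comp_def, Real.sqrt_sq_eq_abs] using this
  have lv : ∀ i, Tendsto (v i) atTop (nhds 0) := by
    intro i
    refine sq0 _ (squeeze_zero (fun t => sq_nonneg _) (fun t => ?_) lg)
    have := Finset.single_le_sum (f := fun i => 2 * v i t ^ 2)
      (fun i _ => by positivity) (Finset.mem_univ i)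
    have h2 := sq_nonneg (v i t)
    simp only [hg] at *
    linarith
  have hmulc : ∀ (f : ℝ → ℝ) i, Tendsto f atTop (nhds 0) →
      Tendsto (fun t => f t * c i t) atTop (nhds 0) := by
    intro f i hf
    refine squeeze_zero_norm (fun t => ?_) (tendsto_zero_iff_abs_tendsto_zero _ |>.1 hf)
    rw [Real.norm_eq_abs, abs_mul]
    exact mul_le_of_le_one_right (abs_nonneg _) (Real.abs_cos_le_one _)
  have hmuls : ∀ (f : ℝ → ℝ) i, Tendsto f atTop (nhds 0) →
      Tendsto (fun t => f t * s i t) atTop (nhds 0) := by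
    intro f i hf
    refine squeeze_zero_norm (fun t => ?_) (tendsto_zero_iff_abs_tendsto_zero _ |>.1 hf)
    rw [Real.norm_eq_abs, abs_mul]
    exact mul_le_of_le_one_right (abs_nonneg _) (Real.abs_sin_le_one _)
  have lp : ∀ j, Tendsto (p j) atTop (nhds 0) := by
    rintro ⟨i, k⟩
    fin_cases k
    · simpa [hp] using hmulc _ i (lv i)
    · simpa [hp] using hmuls _ i (lv i)
  have lu' : ∀ j, Tendsto (u' j) atTop (nhds 0) := by
    intro j
    have := tendsto_finsetSum Finset.univ (fun k _ => (lp k).const_mul (A j k))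
    simpa using this
  -- second application
  have lw : ∀ i, Tendsto (w i) atTop (nhds 0) := by
    intro i
    refine sq0 _ (uc_barbalat (v i) (fun t => w i t ^ 2) (fun t => 2 * (w i t *
      (-(w i t * v i t) + (-s i t * u' (i, 0) t + c i t * u' (i, 1) t))))
      (fun t => c i t * u' (i, 0) t + s i t * u' (i, 1) t) 0 (dv i) (fun t ht => ?_) ?_
      (fun t _ => sq_nonneg _) (lv i) ?_)
    · refine ((dw i t ht).pow 2).congr_deriv ?_
      push_cast
      ring
    · exact (UcBdd.const _).mul ((bw i).mul (((bw i).mul (bv i)).neg.add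
        (((bs i).neg.mul (bu' _)).add ((bc i).mul (bu' _)))))
    · have := (hmulc _ i (lu' (i, 0))).add (hmuls _ i (lu' (i, 1)))
      simpa [mul_comm] using this
  refine uc_dist A q ?_
  rintro ⟨i, k⟩
  fin_cases k
  · have := (hmulc _ i (lv i)).sub (hmuls _ i (lw i))
    rw [sub_zero] at this
    refine this.congr fun t => ?_
    show _ = u (i, 0) t
    simp only [hv, hw]
    linear_combination u (i, 0) t * hcs i t
  · have := (hmuls _ i (lv i)).add (hmulc _ i (lw i))
    rw [add_zero] at this
    refine this.congr fun t => ?_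
    show _ = u (i, 1) t
    simp only [hv, hw]
    linear_combination u (i, 1) t * hcs i t
end

section
/- Let A be a real 2n×2n symmetric negative semidefinite matrix and let v_max, ω_max > 0. For m > 0 define the scalar saturation sat_m : ℝ → ℝ by sat_m(x) = x if |x| ≤ m and sat_m(x) = m·x/|x| otherwise. Let q : ℝ → (ℝ²)ⁿ and θ : ℝ → ℝⁿ be continuously differentiable and suppose that for every agent i and all t ≥ 0, with hᵢ := (cos θᵢ, sin θᵢ), hᵢ⊥ := (−sin θᵢ, cos θᵢ), and uᵢ := (A q(t))ᵢ, the saturated unicycle dynamics hold: q̇ᵢ = sat_{v_max}(⟨hᵢ, uᵢ⟩)·hᵢ and θ̇ᵢ = sat_{ω_max}(⟨hᵢ⊥, uᵢ⟩). Then dist(q(t), ker A) → 0 as t → ∞. -/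
open Filter Matrix

/-- The scalar saturation map: identity on `[−m, m]`, clamping to `±m` outside. -/
noncomputable def satR (m x : ℝ) : ℝ := if |x| ≤ m then x else m * x / |x|

theorem su_mul_satR {m x : ℝ} (hm : 0 < m) : x * satR m x = |x| * min |x| m := by
  unfold satR
  split_ifs with h
  · rw [min_eq_left h, abs_mul_abs_self]
  · push Not at h
    have hx : 0 < |x| := lt_trans hm h
    rw [min_eq_right h.le]
    field_simp
    rw [sq_abs]

theorem su_abs_satR {m x : ℝ} (hm : 0 < m) : |satR m x| = min |x| m := by
  unfold satR
  split_ifs with h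
  · rw [min_eq_left h]
  · push Not at h
    have hx : 0 < |x| := lt_trans hm h
    rw [min_eq_right h.le, abs_div, abs_mul, abs_abs, abs_of_pos hm]
    field_simp

/-- Barbalat-type lemma. -/
theorem su_barbalat {m : ℝ} (hm : 0 < m) (f f' d d' e : ℝ → ℝ) (L l : ℝ)
    (hf : ∀ t, 0 ≤ t → HasDerivAt f (f' t) t)
    (hd : ∀ t, 0 ≤ t → HasDerivAt d (d' t) t)
    (hL : ∀ t, 0 ≤ t → |d' t| ≤ L)
    (he : Tendsto e atTop (nhds 0))
    (hfl : Tendsto f atTop (nhds l))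
    (hlow : ∀ t, 0 ≤ t → d t * satR m (d t) + e t ≤ f' t) :
    Tendsto d atTop (nhds 0) := by
  rw [Metric.tendsto_atTop']
  intro ε hε
  have hL0 : 0 ≤ L := (abs_nonneg _).trans (hL 0 le_rfl)
  set δ : ℝ := ε / (2 * (L + 1)) with hδ
  have hδ0 : 0 < δ := by positivity
  have hLδ : L * δ ≤ ε / 2 := by
    rw [hδ, mul_div_assoc', div_le_div_iff₀ (by positivity) (by positivity)]
    nlinarith
  set η : ℝ := ε / 2 * min (ε / 2) m with hη
  have hη0 : 0 < η := by positivity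
  have h1 : Tendsto (fun t => f (t + δ) - f t) atTop (nhds 0) := by
    have := (hfl.comp (tendsto_atTop_add_const_right atTop δ tendsto_id)).sub hfl
    simpa using this
  have h2 : ∀ᶠ t in atTop, f (t + δ) - f t < η / 2 * δ :=
    h1.eventually_lt_const (by positivity)
  have h3 : ∀ᶠ t in atTop, -(η / 2) < e t := he.eventually_const_lt (by linarith)
  obtain ⟨T, hT⟩ := eventually_atTop.1 (h2.and (h3.and (eventually_ge_atTop (0:ℝ))))
  refine ⟨T, fun t ht => ?_⟩
  rw [Real.dist_eq, sub_zero]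
  by_contra! hcon
  have ht0 : 0 ≤ t := (hT t ht.le).2.2
  have hdist : ∀ s ∈ Set.Icc t (t + δ), ε / 2 ≤ |d s| := by
    intro s hs
    have hb := (convex_Ici (0:ℝ)).norm_image_sub_le_of_norm_hasDerivWithin_le
      (f := d) (f' := d') (C := L) (x := t) (y := s)
      (fun x hx => (hd x hx).hasDerivWithinAt) (fun x hx => hL x hx) ht0 (ht0.trans hs.1)
    rw [Real.norm_eq_abs, Real.norm_eq_abs, abs_of_nonneg (sub_nonneg.2 hs.1)] at hb
    have h4 : L * (s - t) ≤ L * δ := mul_le_mul_of_nonneg_left (by linarith [hs.2]) hL0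
    have h5 := abs_sub_abs_le_abs_sub (d t) (d s)
    rw [abs_sub_comm] at h5
    linarith
  obtain ⟨s, hs, hslope⟩ := exists_hasDerivAt_eq_slope f f' (a := t) (b := t + δ) (by linarith)
    (fun x hx => (hf x (ht0.trans hx.1)).continuousAt.continuousWithinAt)
    (fun x hx => hf x (ht0.trans hx.1.le))
  have h6 := hlow s (ht0.trans hs.1.le)
  rw [su_mul_satR hm] at h6
  have h7 := hdist s ⟨hs.1.le, hs.2.le⟩
  have h8 : η ≤ |d s| * min |d s| m := by
    rw [hη]; gcongr
  have h9 := (hT s (ht.trans hs.1).le).2.1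
  have h10 := (hT t ht.le).1
  rw [eq_div_iff (by linarith)] at hslope
  have h11 : η / 2 * δ ≤ f' s * (t + δ - t) := by
    rw [add_sub_cancel_left]
    exact mul_le_mul_of_nonneg_right (by linarith) hδ0.le
  linarith

theorem su_infDist {ι : Type*} [Fintype ι] [DecidableEq ι] (A : Matrix ι ι ℝ)
    (q : ℝ → EuclideanSpace ℝ ι)
    (h : ∀ p, Tendsto (fun t => A.mulVec (q t) p) atTop (nhds 0)) :
    Tendsto (fun t => Metric.infDist (q t)
        {x : EuclideanSpace ℝ ι | A.mulVec x = 0}) atTop (nhds 0) := by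
  let F : EuclideanSpace ℝ ι →ₗ[ℝ] (ι → ℝ) :=
    A.mulVecLin ∘ₗ (WithLp.linearEquiv 2 ℝ (ι → ℝ)).toLinearMap
  have hF : ∀ x : EuclideanSpace ℝ ι, F x = A.mulVec x := fun x => rfl
  let G : (LinearMap.ker F)ᗮ →ₗ[ℝ] (ι → ℝ) := F ∘ₗ (LinearMap.ker F)ᗮ.subtype
  have hG : LinearMap.ker G = ⊥ := by
    rw [LinearMap.ker_eq_bot']
    rintro ⟨x, hx⟩ hx0
    have h1 : x ∈ LinearMap.ker F := hx0
    have : x = 0 := by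
      have := (Submodule.mem_orthogonal _ x).1 hx x h1
      exact inner_self_eq_zero.1 this
    ext1
    exact this
  obtain ⟨K, hK, hanti⟩ := G.exists_antilipschitzWith hG
  have hbound : ∀ x : EuclideanSpace ℝ ι,
      Metric.infDist x {x : EuclideanSpace ℝ ι | A.mulVec x = 0} ≤ K * ‖A.mulVec x‖ := by
    intro x
    obtain ⟨y, hy, z, hz, hxyz⟩ := (LinearMap.ker F).exists_add_mem_mem_orthogonal x
    have h1 : Metric.infDist x {x : EuclideanSpace ℝ ι | A.mulVec x = 0} ≤ dist x y :=
      Metric.infDist_le_dist_of_mem (by exact hy)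
    have h2 : dist x y = ‖z‖ := by rw [dist_eq_norm, hxyz, add_sub_cancel_left]
    have h3 := hanti.le_mul_dist ⟨z, hz⟩ 0
    rw [map_zero, dist_zero_right, dist_zero_right] at h3
    have h4 : G ⟨z, hz⟩ = A.mulVec x := by
      rw [← hF x, hxyz, map_add, LinearMap.mem_ker.1 hy, zero_add]; rfl
    rw [h4] at h3
    have h5 : ‖z‖ ≤ K * ‖A.mulVec x‖ := h3
    linarith
  have hlim : Tendsto (fun t => A.mulVec (q t)) atTop (nhds 0) := by
    rw [tendsto_pi_nhds]; exact h
  have hlim2 : Tendsto (fun t => (K:ℝ) * ‖A.mulVec (q t)‖) atTop (nhds 0) := by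
    have := hlim.norm.const_mul (K:ℝ)
    simpa using this
  exact squeeze_zero (fun t => Metric.infDist_nonneg) (fun t => hbound (q t)) hlim2

theorem su_cs {ι : Type*} [Fintype ι] [DecidableEq ι] (A : Matrix ι ι ℝ)
    (hsymm : A.IsSymm) (hnsd : ∀ v : ι → ℝ, v ⬝ᵥ A.mulVec v ≤ 0) (x : ι → ℝ) (p : ι) :
    (A.mulVec x p) ^ 2 ≤ A p p * (x ⬝ᵥ A.mulVec x) := by
  have h : ∀ s : ℝ, 0 ≤ (-A p p) * (s * s) + (-2 * A.mulVec x p) * s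
      + -(x ⬝ᵥ A.mulVec x) := by
    intro s
    have h1 := hnsd (x + s • Pi.single p 1)
    have h2 : x ⬝ᵥ A.mulVec (Pi.single p 1) = A.mulVec x p := by
      rw [Matrix.dotProduct_mulVec, ← Matrix.mulVec_transpose, hsymm.eq, dotProduct_single_one]
    have h3 : (Pi.single p (1:ℝ)) ⬝ᵥ A.mulVec (Pi.single p 1) = A p p := by
      simp
    rw [Matrix.mulVec_add, Matrix.mulVec_smul, dotProduct_add, add_dotProduct, add_dotProduct,
      dotProduct_smul, dotProduct_smul, smul_dotProduct, smul_dotProduct, h2, h3,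
      single_one_dotProduct] at h1
    simp only [smul_eq_mul] at h1
    linarith
  have := discrim_le_zero h
  unfold discrim at this
  linarith

/-- Under the saturated unicycle closed-loop dynamics
`q̇ᵢ = sat_{v_max}(⟨hᵢ, uᵢ⟩) hᵢ`, `θ̇ᵢ = sat_{ω_max}(⟨hᵢ⊥, uᵢ⟩)` with `uᵢ = (A q)ᵢ`,
where `A` is symmetric negative semidefinite, `dist (q t, ker A) → 0`. -/
theorem saturated_unicycle_converges
    (n : ℕ) (A : Matrix (Fin n × Fin 2) (Fin n × Fin 2) ℝ)
    (hsymm : A.IsSymm) (hnsd : ∀ v : Fin n × Fin 2 → ℝ, v ⬝ᵥ A.mulVec v ≤ 0)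
    (vmax ωmax : ℝ) (hv : 0 < vmax) (hω : 0 < ωmax)
    (q : ℝ → EuclideanSpace ℝ (Fin n × Fin 2)) (θ : ℝ → Fin n → ℝ)
    (hq : ContDiff ℝ 1 q) (hθ : ContDiff ℝ 1 θ)
    (hdyn : ∀ t : ℝ, 0 ≤ t → ∀ i : Fin n,
      HasDerivAt (fun s => q s (i, 0))
        (satR vmax (Real.cos (θ t i) * A.mulVec (q t) (i, 0) +
          Real.sin (θ t i) * A.mulVec (q t) (i, 1)) * Real.cos (θ t i)) t ∧
      HasDerivAt (fun s => q s (i, 1))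
        (satR vmax (Real.cos (θ t i) * A.mulVec (q t) (i, 0) +
          Real.sin (θ t i) * A.mulVec (q t) (i, 1)) * Real.sin (θ t i)) t ∧
      HasDerivAt (fun s => θ s i)
        (satR ωmax (-Real.sin (θ t i) * A.mulVec (q t) (i, 0) +
          Real.cos (θ t i) * A.mulVec (q t) (i, 1))) t) :
    Tendsto (fun t => Metric.infDist (q t)
        {x : EuclideanSpace ℝ (Fin n × Fin 2) | A.mulVec x = 0}) atTop (nhds 0) := by
  set u : ℝ → Fin n × Fin 2 → ℝ := fun t => A.mulVec (q t) with hu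
  set c : ℝ → Fin n → ℝ := fun t i =>
    Real.cos (θ t i) * u t (i, 0) + Real.sin (θ t i) * u t (i, 1) with hc
  set d : ℝ → Fin n → ℝ := fun t i =>
    -Real.sin (θ t i) * u t (i, 0) + Real.cos (θ t i) * u t (i, 1) with hd
  set qd : ℝ → Fin n × Fin 2 → ℝ := fun t p =>
    satR vmax (c t p.1) * (if p.2 = 0 then Real.cos (θ t p.1) else Real.sin (θ t p.1)) with hqd
  set ud : ℝ → Fin n × Fin 2 → ℝ := fun t => A.mulVec (qd t) with hud
  have hqD : ∀ t, 0 ≤ t → ∀ p, HasDerivAt (fun s => q s p) (qd t p) t := by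
    rintro t ht ⟨i, j⟩
    obtain ⟨h0, h1, -⟩ := hdyn t ht i
    fin_cases j
    · simpa [hqd] using h0
    · simpa [hqd] using h1
  have hθD : ∀ t, 0 ≤ t → ∀ i, HasDerivAt (fun s => θ s i) (satR ωmax (d t i)) t :=
    fun t ht i => (hdyn t ht i).2.2
  have huD : ∀ t, 0 ≤ t → ∀ p, HasDerivAt (fun s => u s p) (ud t p) t := by
    intro t ht p
    simp only [hu, hud, Matrix.mulVec, dotProduct]
    exact HasDerivAt.fun_sum fun k _ => (hqD t ht k).const_mul (A p k)
  have hqdle : ∀ t p, |qd t p| ≤ |satR vmax (c t p.1)| := by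
    intro t p
    simp only [hqd, abs_mul]
    apply mul_le_of_le_one_right (abs_nonneg _)
    split_ifs
    · exact Real.abs_cos_le_one _
    · exact Real.abs_sin_le_one _
  have hqdb : ∀ t p, |qd t p| ≤ vmax := fun t p =>
    (hqdle t p).trans (by rw [su_abs_satR hv]; exact min_le_right _ _)
  have hudb : ∀ t p, |ud t p| ≤ ∑ k, |A p k| * vmax := by
    intro t p
    simp only [hud, Matrix.mulVec, dotProduct]
    refine (Finset.abs_sum_le_sum_abs _ _).trans (Finset.sum_le_sum fun k _ => ?_)
    rw [abs_mul]
    exact mul_le_mul_of_nonneg_left (hqdb t k) (abs_nonneg _)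
  -- derivatives of c and d
  have hcD : ∀ t, 0 ≤ t → ∀ i, HasDerivAt (fun s => c s i)
      (d t i * satR ωmax (d t i) +
        (Real.cos (θ t i) * ud t (i, 0) + Real.sin (θ t i) * ud t (i, 1))) t := by
    intro t ht i
    have := ((hθD t ht i).cos.mul (huD t ht (i, 0))).add
      ((hθD t ht i).sin.mul (huD t ht (i, 1)))
    refine HasDerivAt.congr_deriv this ?_
    simp only [hd]; ring
  have hdD : ∀ t, 0 ≤ t → ∀ i, HasDerivAt (fun s => d s i)
      (-(c t i * satR ωmax (d t i)) +
        (-Real.sin (θ t i) * ud t (i, 0) + Real.cos (θ t i) * ud t (i, 1))) t := by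
    intro t ht i
    have := ((hθD t ht i).sin.neg.mul (huD t ht (i, 0))).add
      ((hθD t ht i).cos.mul (huD t ht (i, 1)))
    refine HasDerivAt.congr_deriv this ?_
    simp only [hc, Pi.neg_apply]; ring
  -- Lyapunov function
  set W : ℝ → ℝ := fun t => (q t) ⬝ᵥ u t with hW
  have hWD : ∀ t, 0 ≤ t → HasDerivAt W (2 * ∑ i, c t i * satR vmax (c t i)) t := by
    intro t ht
    have h1 : HasDerivAt W (∑ p, (qd t p * u t p + q t p * ud t p)) t := by
      simp only [hW, dotProduct]
      exact HasDerivAt.fun_sum fun k _ => (hqD t ht k).mul (huD t ht k)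
    refine h1.congr_deriv ?_
    have h2 : ∑ p, q t p * ud t p = ∑ p, qd t p * u t p := by
      change (q t) ⬝ᵥ A.mulVec (qd t) = qd t ⬝ᵥ A.mulVec (q t)
      rw [Matrix.dotProduct_mulVec, ← Matrix.mulVec_transpose, hsymm.eq, dotProduct_comm]
    rw [Finset.sum_add_distrib, h2, ← two_mul, Fintype.sum_prod_type]
    congr 1
    refine Finset.sum_congr rfl fun i _ => ?_
    simp only [Fin.sum_univ_two, hqd, hc]
    simp
    ring
  have hcs0 : ∀ t i, 0 ≤ c t i * satR vmax (c t i) := fun t i => by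
    rw [su_mul_satR hv]; positivity
  have hWmono : MonotoneOn W (Set.Ici 0) := by
    apply monotoneOn_of_deriv_nonneg (convex_Ici 0)
    · exact fun t ht => (hWD t ht).continuousAt.continuousWithinAt
    · intro t ht
      rw [interior_Ici] at ht
      exact (hWD t (le_of_lt ht)).differentiableAt.differentiableWithinAt
    · intro t ht
      rw [interior_Ici] at ht
      rw [(hWD t (le_of_lt ht)).deriv]
      exact mul_nonneg zero_le_two (Finset.sum_nonneg fun i _ => hcs0 t i)
  have hW0 : ∀ t, W t ≤ 0 := fun t => hnsd (q t)
  obtain ⟨l, hl⟩ : ∃ l, Tendsto W atTop (nhds l) := by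
    have hm : Monotone fun t => W (max t 0) := fun a b hab =>
      hWmono (Set.mem_Ici.2 (le_max_right _ _)) (Set.mem_Ici.2 (le_max_right _ _)) (max_le_max_right 0 hab)
    have hb : BddAbove (Set.range fun t => W (max t 0)) := ⟨0, by
      rintro _ ⟨t, rfl⟩; exact hW0 _⟩
    refine ⟨_, (tendsto_atTop_ciSup hm hb).congr' ?_⟩
    filter_upwards [eventually_ge_atTop (0:ℝ)] with t ht
    rw [max_eq_left ht]
  have hub : ∀ p, ∃ U, ∀ t, 0 ≤ t → |u t p| ≤ U := by
    intro p
    refine ⟨|A p p| * |W 0| + 1, fun t ht => ?_⟩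
    have h1 : (u t p) ^ 2 ≤ A p p * W t := su_cs A hsymm hnsd (q t) p
    have h2 : A p p * W t ≤ |A p p| * |W 0| := by
      refine (le_abs_self _).trans ?_
      rw [abs_mul]
      refine mul_le_mul_of_nonneg_left ?_ (abs_nonneg _)
      have h3 : W 0 ≤ W t := hWmono (Set.mem_Ici.2 le_rfl) ht ht
      rw [abs_of_nonpos (hW0 t), abs_of_nonpos (hW0 0)]
      linarith
    have h4 := sq_abs (u t p)
    nlinarith [sq_nonneg (|u t p| - 1)]
  choose U hU using hub
  have htrig : ∀ x a b : ℝ, |Real.cos x * a + Real.sin x * b| ≤ |a| + |b| := by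
    intro x a b
    refine (abs_add_le _ _).trans (add_le_add ?_ ?_) <;> rw [abs_mul]
    · exact mul_le_of_le_one_left (abs_nonneg _) (Real.abs_cos_le_one _)
    · exact mul_le_of_le_one_left (abs_nonneg _) (Real.abs_sin_le_one _)
  have htrig' : ∀ x a b : ℝ, |-Real.sin x * a + Real.cos x * b| ≤ |a| + |b| := by
    intro x a b
    refine (abs_add_le _ _).trans (add_le_add ?_ ?_) <;> rw [abs_mul]
    · rw [abs_neg]
      exact mul_le_of_le_one_left (abs_nonneg _) (Real.abs_sin_le_one _)
    · exact mul_le_of_le_one_left (abs_nonneg _) (Real.abs_cos_le_one _)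
  have hcb : ∀ t, 0 ≤ t → ∀ i, |c t i| ≤ U (i, 0) + U (i, 1) := fun t ht i =>
    (htrig _ _ _).trans (add_le_add (hU _ t ht) (hU _ t ht))
  have hdb : ∀ t, 0 ≤ t → ∀ i, |d t i| ≤ U (i, 0) + U (i, 1) := fun t ht i =>
    (htrig' _ _ _).trans (add_le_add (hU _ t ht) (hU _ t ht))
  have hsω : ∀ x, |satR ωmax x| ≤ ωmax := fun x => by
    rw [su_abs_satR hω]; exact min_le_right _ _
  have hprod : ∀ t, 0 ≤ t → ∀ i x, |x| ≤ U (i, 0) + U (i, 1) →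
      |x * satR ωmax (d t i)| ≤ (U (i, 0) + U (i, 1)) * ωmax := by
    intro t ht i x hx
    rw [abs_mul]
    exact mul_le_mul hx (hsω _) (abs_nonneg _) ((abs_nonneg _).trans hx)
  -- c tends to 0
  have hc0 : ∀ i, Tendsto (fun t => c t i) atTop (nhds 0) := by
    intro i
    refine su_barbalat hv W _ (fun t => c t i) _ (fun _ => 0)
      ((U (i, 0) + U (i, 1)) * ωmax + (∑ k, |A (i, 0) k| * vmax + ∑ k, |A (i, 1) k| * vmax)) l
      hWD (fun t ht => hcD t ht i) ?_ tendsto_const_nhds hl ?_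
    · intro t ht
      exact (abs_add_le _ _).trans (add_le_add (hprod t ht i _ (hdb t ht i))
        ((htrig _ _ _).trans (add_le_add (hudb _ _) (hudb _ _))))
    · intro t ht
      have h1 : c t i * satR vmax (c t i) ≤ ∑ i, c t i * satR vmax (c t i) :=
        Finset.single_le_sum (f := fun i => c t i * satR vmax (c t i))
          (fun i _ => hcs0 t i) (Finset.mem_univ i)
      have h2 := hcs0 t i
      linarith
  have hqd0 : ∀ p, Tendsto (fun t => qd t p) atTop (nhds 0) := by
    intro p
    refine squeeze_zero_norm (a := fun t => |c t p.1|) (fun t => ?_) (by simpa using (hc0 p.1).abs)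
    refine (hqdle t p).trans ?_
    rw [su_abs_satR hv]; exact min_le_left _ _
  have hud0 : ∀ p, Tendsto (fun t => ud t p) atTop (nhds 0) := by
    intro p
    simp only [hud, Matrix.mulVec, dotProduct]
    have := tendsto_finsetSum (Finset.univ) fun k _ => (hqd0 k).const_mul (A p k)
    simpa using this
  have hd0 : ∀ i, Tendsto (fun t => d t i) atTop (nhds 0) := by
    intro i
    refine su_barbalat hω (fun t => c t i) _ (fun t => d t i) _
      (fun t => -(|ud t (i, 0)| + |ud t (i, 1)|))
      ((U (i, 0) + U (i, 1)) * ωmax + (∑ k, |A (i, 0) k| * vmax + ∑ k, |A (i, 1) k| * vmax)) 0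
      (fun t ht => hcD t ht i) (fun t ht => hdD t ht i) ?_ ?_ (hc0 i) ?_
    · intro t ht
      refine (abs_add_le _ _).trans (add_le_add ?_
        ((htrig' _ _ _).trans (add_le_add (hudb _ _) (hudb _ _))))
      rw [abs_neg]
      exact hprod t ht i _ (hcb t ht i)
    · simpa using ((hud0 (i, 0)).abs.add (hud0 (i, 1)).abs).neg
    · intro t ht
      have := (abs_le.1 (htrig (θ t i) (ud t (i, 0)) (ud t (i, 1)))).1
      linarith
  apply su_infDist A q
  have hle : ∀ t i, |u t (i, 0)| ≤ |c t i| + |d t i| ∧ |u t (i, 1)| ≤ |c t i| + |d t i| := by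
    intro t i
    have hsc := Real.sin_sq_add_cos_sq (θ t i)
    have e0 : u t (i, 0) = Real.cos (θ t i) * c t i + Real.sin (θ t i) * (-d t i) := by
      simp only [hc, hd]; linear_combination (-u t (i, 0)) * hsc
    have e1 : u t (i, 1) = Real.cos (θ t i) * d t i + Real.sin (θ t i) * (c t i) := by
      simp only [hc, hd]; linear_combination (-u t (i, 1)) * hsc
    constructor
    · rw [e0]; simpa using htrig (θ t i) (c t i) (-d t i)
    · rw [e1, add_comm |c t i|]; exact htrig (θ t i) (d t i) (c t i)
  have hsum : ∀ i, Tendsto (fun t => |c t i| + |d t i|) atTop (nhds 0) := fun i => by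
    simpa using (hc0 i).abs.add (hd0 i).abs
  rintro ⟨i, j⟩
  refine squeeze_zero_norm (fun t => ?_) (hsum i)
  fin_cases j
  · exact (hle t i).1
  · exact (hle t i).2
end

section
/- Let A be a real 2n×2n symmetric negative semidefinite matrix, let l > 0, and let a, b, c, d > 0 be real constants. Let q : ℝ → (ℝ²)ⁿ, v : ℝ → ℝⁿ, θ : ℝ → ℝⁿ, δ : ℝ → ℝⁿ, ω : ℝ → ℝⁿ be continuously differentiable and suppose that for every agent i and all t ≥ 0, with gᵢ := (cos δᵢ, sin δᵢ), gᵢ⊥ := (−sin δᵢ, cos δᵢ), hᵢ⊥ := (−sin θᵢ, cos θᵢ), and uᵢ := (A q(t))ᵢ, the car dynamics with linear actuator dynamics hold: q̇ᵢ = vᵢ·gᵢ, v̇ᵢ = −a·vᵢ + b·⟨gᵢ, uᵢ⟩, θ̇ᵢ = (vᵢ/l)·⟨hᵢ⊥, gᵢ⟩, δ̇ᵢ = (vᵢ/l)·⟨hᵢ⊥, gᵢ⟩ + ωᵢ, and ω̇ᵢ = −c·ωᵢ + d·⟨gᵢ⊥, uᵢ⟩. Then dist(q(t), ker A) → 0 and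 v(t) → 0 as t → ∞. -/
open Filter Matrix

namespace CarAux

/-- Boundedness on the half line `t ≥ 0`. -/
def Bd (f : ℝ → ℝ) : Prop := ∃ M : ℝ, ∀ t : ℝ, 0 ≤ t → |f t| ≤ M

lemma Bd.add {f g : ℝ → ℝ} (hf : Bd f) (hg : Bd g) : Bd (fun t => f t + g t) := by
  obtain ⟨M, hM⟩ := hf
  obtain ⟨N, hN⟩ := hg
  exact ⟨M + N, fun t ht => (abs_add_le _ _).trans (add_le_add (hM t ht) (hN t ht))⟩

lemma Bd.mul {f g : ℝ → ℝ} (hf : Bd f) (hg : Bd g) : Bd (fun t => f t * g t) := by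
  obtain ⟨M, hM⟩ := hf
  obtain ⟨N, hN⟩ := hg
  refine ⟨M * N, fun t ht => ?_⟩
  rw [abs_mul]
  exact mul_le_mul (hM t ht) (hN t ht) (abs_nonneg _) ((abs_nonneg _).trans (hM t ht))

lemma Bd.neg {f : ℝ → ℝ} (hf : Bd f) : Bd (fun t => - f t) := by
  obtain ⟨M, hM⟩ := hf
  exact ⟨M, fun t ht => by rw [abs_neg]; exact hM t ht⟩

lemma Bd.const (r : ℝ) : Bd (fun _ => r) := ⟨|r|, fun _ _ => le_rfl⟩

lemma Bd.sum {ι : Type*} (s : Finset ι) {f : ι → ℝ → ℝ} (hf : ∀ i, Bd (f i)) :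
    Bd (fun t => ∑ i ∈ s, f i t) := by
  choose M hM using hf
  exact ⟨∑ i ∈ s, M i, fun t ht =>
    (Finset.abs_sum_le_sum_abs _ _).trans (Finset.sum_le_sum fun i _ => hM i t ht)⟩

lemma Bd.sin (f : ℝ → ℝ) : Bd (fun t => Real.sin (f t)) :=
  ⟨1, fun _ _ => Real.abs_sin_le_one _⟩

lemma Bd.cos (f : ℝ → ℝ) : Bd (fun t => Real.cos (f t)) :=
  ⟨1, fun _ _ => Real.abs_cos_le_one _⟩

lemma Bd.mul_tendsto {f g : ℝ → ℝ} (hf : Bd f) (hg : Tendsto g atTop (nhds 0)) :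
    Tendsto (fun t => f t * g t) atTop (nhds 0) := by
  obtain ⟨M, hM⟩ := hf
  have h1 : Tendsto (fun t => M * |g t|) atTop (nhds 0) := by
    simpa using (hg.abs).const_mul M
  refine squeeze_zero_norm' ?_ h1
  filter_upwards [eventually_ge_atTop (0 : ℝ)] with t ht
  rw [Real.norm_eq_abs, abs_mul]
  exact mul_le_mul_of_nonneg_right (hM t ht) (abs_nonneg _)

lemma pow_eq_zero_iff_tendsto {f : ℝ → ℝ} (h : Tendsto (fun t => f t ^ 2) atTop (nhds 0)) :
    Tendsto f atTop (nhds 0) := by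
  have h1 := h.sqrt
  simp only [Real.sqrt_sq_eq_abs, Real.sqrt_zero] at h1
  exact (tendsto_zero_iff_abs_tendsto_zero f).2 h1

/-- A Barbalat type lemma. -/
lemma barbalat {f g e g' : ℝ → ℝ} {L : ℝ} (hf : Tendsto f atTop (nhds L))
    (he : Tendsto e atTop (nhds 0))
    (hfd : ∀ t, 0 ≤ t → HasDerivAt f (g t + e t) t)
    (hgd : ∀ t, 0 ≤ t → HasDerivAt g (g' t) t)
    (hb : Bd g') : Tendsto g atTop (nhds 0) := by
  obtain ⟨M, hM⟩ := hb
  have hM0 : 0 ≤ M := (abs_nonneg _).trans (hM 0 le_rfl)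
  rw [Metric.tendsto_atTop]
  intro ε hε
  set h : ℝ := ε / (3 * (M + 1)) with hh
  have hpos : 0 < h := by positivity
  have hMh : M * h < ε / 3 := by
    rw [hh, mul_div_assoc', div_lt_div_iff₀ (by positivity) (by norm_num)]
    nlinarith
  obtain ⟨N1, hN1⟩ := (Metric.tendsto_atTop.1 hf) (ε / 6 * h) (by positivity)
  obtain ⟨N2, hN2⟩ := (Metric.tendsto_atTop.1 he) (ε / 3) (by positivity)
  refine ⟨max (max N1 N2) 0, fun t ht => ?_⟩
  have ht0 : 0 ≤ t := (le_max_right _ _).trans ht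
  have ht1 : N1 ≤ t := ((le_max_left _ _).trans (le_max_left _ _)).trans ht
  have ht2 : N2 ≤ t := ((le_max_right _ _).trans (le_max_left _ _)).trans ht
  obtain ⟨x, hx, hx'⟩ := exists_hasDerivAt_eq_slope f (fun t => g t + e t)
    (show t < t + h by linarith)
    (fun s hs => ((hfd s (ht0.trans hs.1)).continuousAt).continuousWithinAt)
    (fun s hs => hfd s (ht0.trans hs.1.le))
  obtain ⟨y, hy, hy'⟩ := exists_hasDerivAt_eq_slope g g' hx.1
    (fun s hs => ((hgd s (ht0.trans hs.1)).continuousAt).continuousWithinAt)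
    (fun s hs => hgd s (ht0.trans hs.1.le))
  have e1 := hN1 t ht1
  have e2 := hN1 (t + h) (by linarith)
  have e3 := hN2 x (by linarith [hx.1])
  rw [Real.dist_eq] at e1 e2 e3 ⊢
  rw [abs_lt] at e1 e2 e3
  have e4 := hM y (ht0.trans hy.1.le)
  rw [abs_le] at e4
  have hxt : 0 < x - t := sub_pos.2 hx.1
  rw [eq_div_iff hxt.ne'] at hy'
  rw [add_sub_cancel_left, eq_div_iff hpos.ne'] at hx'
  have k1 : g x + e x < ε / 3 := by
    by_contra hcon
    push Not at hcon
    nlinarith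
  have k2 : -(ε / 3) < g x + e x := by
    by_contra hcon
    push Not at hcon
    nlinarith
  have hxh : x - t ≤ h := by linarith [hx.2]
  have k3 : g x - g t ≤ M * h := by
    rw [← hy']
    nlinarith
  have k4 : -(M * h) ≤ g x - g t := by
    rw [← hy']
    nlinarith
  rw [abs_lt]
  constructor <;> linarith

lemma upper_bound {f w : ℝ → ℝ} {c W : ℝ} (hc : 0 < c)
    (hfd : ∀ t, 0 ≤ t → HasDerivAt f (-c * f t + w t) t)
    (hw : ∀ t, 0 ≤ t → w t ≤ W) (hW : 0 ≤ W) :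
    ∀ t, 0 ≤ t → f t ≤ W / c + |f 0| := by
  have hder : ∀ t, 0 ≤ t → HasDerivAt (fun t => Real.exp (c * t) * (f t - W / c))
      (Real.exp (c * t) * (w t - W)) t := by
    intro t ht
    have h1 : HasDerivAt (fun t => Real.exp (c * t)) (Real.exp (c * t) * c) t := by
      simpa using ((hasDerivAt_id t).const_mul c).exp
    refine (h1.mul ((hfd t ht).sub_const (W / c))).congr_deriv ?_
    field_simp
    ring
  have hanti : AntitoneOn (fun t => Real.exp (c * t) * (f t - W / c)) (Set.Ici 0) := by
    refine antitoneOn_of_deriv_nonpos (convex_Ici 0)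
      (fun t ht => (hder t ht).continuousAt.continuousWithinAt)
      (fun t ht => ?_) (fun t ht => ?_)
    · rw [interior_Ici] at ht
      exact (hder t (le_of_lt ht)).differentiableAt.differentiableWithinAt
    · rw [interior_Ici] at ht
      rw [(hder t (le_of_lt ht)).deriv]
      have := hw t (le_of_lt ht)
      exact mul_nonpos_of_nonneg_of_nonpos (Real.exp_pos _).le (by linarith)
  intro t ht
  have h := hanti (Set.mem_Ici.2 le_rfl) (Set.mem_Ici.2 ht) ht
  simp only [mul_zero, Real.exp_zero, one_mul] at h
  by_contra hcon
  push Not at hcon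
  have h1 : 1 ≤ Real.exp (c * t) := Real.one_le_exp (by positivity)
  have h2 : 0 ≤ W / c := by positivity
  have h3 := le_abs_self (f 0)
  have h4 := abs_nonneg (f 0)
  nlinarith

lemma linear_bd {f w : ℝ → ℝ} {c : ℝ} (hc : 0 < c)
    (hfd : ∀ t, 0 ≤ t → HasDerivAt f (-c * f t + w t) t) (hw : Bd w) : Bd f := by
  obtain ⟨W, hW⟩ := hw
  have hW0 : 0 ≤ W := (abs_nonneg _).trans (hW 0 le_rfl)
  refine ⟨W / c + |f 0|, fun t ht => ?_⟩
  rw [abs_le]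
  have h1 := upper_bound hc hfd (fun t ht => (abs_le.1 (hW t ht)).2) hW0 t ht
  have h2 := upper_bound (f := fun t => - f t) (w := fun t => - w t) hc
    (fun t ht => (hfd t ht).neg.congr_deriv (by ring))
    (fun t ht => by linarith [(abs_le.1 (hW t ht)).1]) hW0 t ht
  simp only [abs_neg] at h2
  exact ⟨by linarith, h1⟩

/-- Cauchy-Schwarz for the semidefinite form, one coordinate. -/
lemma sq_le {ι : Type*} [Fintype ι] [DecidableEq ι] (A : Matrix ι ι ℝ)
    (hsymm : A.IsSymm) (hnsd : ∀ w : ι → ℝ, w ⬝ᵥ A.mulVec w ≤ 0) (x : ι → ℝ) (j : ι) :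
    (A.mulVec x j) ^ 2 ≤ A j j * (x ⬝ᵥ A.mulVec x) := by
  have key : ∀ r : ℝ, 0 ≤ (-(A j j)) * (r * r) + (-2 * A.mulVec x j) * r
      + (-(x ⬝ᵥ A.mulVec x)) := by
    intro r
    have h := hnsd (x + r • Pi.single j 1)
    have h2 : x ⬝ᵥ A.mulVec (Pi.single j 1) = A.mulVec x j := by
      rw [dotProduct_mulVec, ← mulVec_transpose, hsymm.eq]
      simp
    rw [mulVec_add, mulVec_smul, add_dotProduct, dotProduct_add, dotProduct_add, smul_dotProduct,
      smul_dotProduct, dotProduct_smul, dotProduct_smul, h2] at h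
    simp at h
    nlinarith
  have := discrim_le_zero key
  rw [discrim] at this
  nlinarith

lemma infDist_tendsto {ι : Type*} [Fintype ι] [DecidableEq ι] (A : Matrix ι ι ℝ)
    (q : ℝ → EuclideanSpace ℝ ι)
    (h : ∀ j, Tendsto (fun t => A.mulVec (q t) j) atTop (nhds 0)) :
    Tendsto (fun t => Metric.infDist (q t)
        {x : EuclideanSpace ℝ ι | A.mulVec x = 0}) atTop (nhds 0) := by
  let T : EuclideanSpace ℝ ι →ₗ[ℝ] (ι → ℝ) :=
    A.mulVecLin ∘ₗ (WithLp.linearEquiv 2 ℝ (ι → ℝ)).toLinearMap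
  have hT : ∀ x : EuclideanSpace ℝ ι, T x = A.mulVec x := fun x => rfl
  obtain ⟨S, hS⟩ := T.rangeRestrict.exists_rightInverse_of_surjective T.range_rangeRestrict
  have hcont : Continuous S := S.continuous_of_finiteDimensional
  have hq0 : Tendsto (fun t => T.rangeRestrict (q t)) atTop (nhds 0) := by
    rw [tendsto_subtype_rng]
    rw [tendsto_pi_nhds]
    intro j
    exact h j
  have h3 : Tendsto (fun t => ‖S (T.rangeRestrict (q t))‖) atTop (nhds 0) := by
    have := (hcont.tendsto 0).comp hq0
    rw [map_zero] at this
    simpa using this.norm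
  refine squeeze_zero (fun t => Metric.infDist_nonneg) (fun t => ?_) h3
  have hmem : q t - S (T.rangeRestrict (q t)) ∈
      {x : EuclideanSpace ℝ ι | A.mulVec x = 0} := by
    change T (q t - S (T.rangeRestrict (q t))) = 0
    have h4 := congrArg Subtype.val (LinearMap.congr_fun hS (T.rangeRestrict (q t)))
    have h5 : T (S (T.rangeRestrict (q t))) = T (q t) := h4
    rw [map_sub, h5, sub_self]
  refine (Metric.infDist_le_dist_of_mem hmem).trans ?_
  rw [dist_eq_norm]
  simp

end CarAux

open CarAux

/-- Under the front-wheel drive car dynamics with unmodeled linear actuator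
dynamics `q̇ᵢ = vᵢ gᵢ`, `v̇ᵢ = −a vᵢ + b ⟨gᵢ, uᵢ⟩`, `θ̇ᵢ = (vᵢ/l) ⟨hᵢ⊥, gᵢ⟩`,
`δ̇ᵢ = (vᵢ/l) ⟨hᵢ⊥, gᵢ⟩ + ωᵢ`, `ω̇ᵢ = −c ωᵢ + d ⟨gᵢ⊥, uᵢ⟩`, with `uᵢ = (A q)ᵢ`,
`a, b, c, d > 0` and `A` symmetric negative semidefinite, `dist (q t, ker A) → 0` and
`v t → 0`. -/
theorem car_actuator_dynamics_converges
    (n : ℕ) (A : Matrix (Fin n × Fin 2) (Fin n × Fin 2) ℝ)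
    (hsymm : A.IsSymm) (hnsd : ∀ w : Fin n × Fin 2 → ℝ, w ⬝ᵥ A.mulVec w ≤ 0)
    (l : ℝ) (hl : 0 < l)
    (a b c d : ℝ) (ha : 0 < a) (hb : 0 < b) (hc : 0 < c) (hd : 0 < d)
    (q : ℝ → EuclideanSpace ℝ (Fin n × Fin 2)) (v : ℝ → Fin n → ℝ)
    (θ : ℝ → Fin n → ℝ) (δ : ℝ → Fin n → ℝ) (ω : ℝ → Fin n → ℝ)
    (hq : ContDiff ℝ 1 q) (hv : ContDiff ℝ 1 v) (hθ : ContDiff ℝ 1 θ)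
    (hδ : ContDiff ℝ 1 δ) (hω : ContDiff ℝ 1 ω)
    (hdyn : ∀ t : ℝ, 0 ≤ t → ∀ i : Fin n,
      HasDerivAt (fun s => q s (i, 0)) (v t i * Real.cos (δ t i)) t ∧
      HasDerivAt (fun s => q s (i, 1)) (v t i * Real.sin (δ t i)) t ∧
      HasDerivAt (fun s => v s i)
        (-a * v t i + b * (Real.cos (δ t i) * A.mulVec (q t) (i, 0) +
          Real.sin (δ t i) * A.mulVec (q t) (i, 1))) t ∧
      HasDerivAt (fun s => θ s i)
        ((v t i / l) * (-Real.sin (θ t i) * Real.cos (δ t i) +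
          Real.cos (θ t i) * Real.sin (δ t i))) t ∧
      HasDerivAt (fun s => δ s i)
        ((v t i / l) * (-Real.sin (θ t i) * Real.cos (δ t i) +
          Real.cos (θ t i) * Real.sin (δ t i)) + ω t i) t ∧
      HasDerivAt (fun s => ω s i)
        (-c * ω t i + d * (-Real.sin (δ t i) * A.mulVec (q t) (i, 0) +
          Real.cos (δ t i) * A.mulVec (q t) (i, 1))) t) :
    Tendsto (fun t => Metric.infDist (q t)
        {x : EuclideanSpace ℝ (Fin n × Fin 2) | A.mulVec x = 0}) atTop (nhds 0) ∧
    Tendsto v atTop (nhds 0) := by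
  classical
  -- abbreviations
  set u : Fin n × Fin 2 → ℝ → ℝ := fun j t => A.mulVec (q t) j with hu
  set qd : Fin n × Fin 2 → ℝ → ℝ := fun j t =>
    v t j.1 * (if j.2 = 0 then Real.cos (δ t j.1) else Real.sin (δ t j.1)) with hqd
  set ud : Fin n × Fin 2 → ℝ → ℝ := fun j t => ∑ k, A j k * qd k t with hud
  set s : Fin n → ℝ → ℝ := fun i t =>
    Real.cos (δ t i) * u (i, 0) t + Real.sin (δ t i) * u (i, 1) t with hs
  set p : Fin n → ℝ → ℝ := fun i t =>
    -Real.sin (δ t i) * u (i, 0) t + Real.cos (δ t i) * u (i, 1) t with hp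
  set κ : Fin n → ℝ → ℝ := fun i t =>
    (v t i / l) * (-Real.sin (θ t i) * Real.cos (δ t i) +
          Real.cos (θ t i) * Real.sin (δ t i)) with hκ
  have dq : ∀ j t, 0 ≤ t → HasDerivAt (fun r => q r j) (qd j t) t := by
    rintro ⟨i, k⟩ t ht
    fin_cases k
    · simpa [hqd] using (hdyn t ht i).1
    · simpa [hqd] using (hdyn t ht i).2.1
  have dv : ∀ i t, 0 ≤ t → HasDerivAt (fun r => v r i) (-a * v t i + b * s i t) t :=
    fun i t ht => (hdyn t ht i).2.2.1
  have dδ : ∀ i t, 0 ≤ t → HasDerivAt (fun r => δ r i) (κ i t + ω t i) t :=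
    fun i t ht => (hdyn t ht i).2.2.2.2.1
  have dω : ∀ i t, 0 ≤ t → HasDerivAt (fun r => ω r i) (-c * ω t i + d * p i t) t :=
    fun i t ht => (hdyn t ht i).2.2.2.2.2
  clear hdyn
  have du : ∀ j t, 0 ≤ t → HasDerivAt (u j) (ud j t) t := by
    intro j t ht
    have h : HasDerivAt (fun r => ∑ k, A j k * q r k) (∑ k, A j k * qd k t) t :=
      HasDerivAt.fun_sum fun k _ => (dq k t ht).const_mul (A j k)
    exact h
  have ds : ∀ i t, 0 ≤ t → HasDerivAt (s i) ((κ i t + ω t i) * p i t +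
      (Real.cos (δ t i) * ud (i, 0) t + Real.sin (δ t i) * ud (i, 1) t)) t := by
    intro i t ht
    refine (((dδ i t ht).cos.mul (du (i, 0) t ht)).add
      ((dδ i t ht).sin.mul (du (i, 1) t ht))).congr_deriv ?_
    simp only [hp]
    ring
  have dp : ∀ i t, 0 ≤ t → HasDerivAt (p i) (-(κ i t + ω t i) * s i t +
      (-Real.sin (δ t i) * ud (i, 0) t + Real.cos (δ t i) * ud (i, 1) t)) t := by
    intro i t ht
    refine (((dδ i t ht).sin.fun_neg.mul (du (i, 0) t ht)).add
      ((dδ i t ht).cos.mul (du (i, 1) t ht))).congr_deriv ?_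
    simp only [hs]
    ring
  -- Lyapunov function
  set V : ℝ → ℝ := fun t => -(1 / 2) * (∑ j, q t j * u j t) + 1 / (2 * b) * ∑ i, v t i ^ 2 with hV
  have dV : ∀ t, 0 ≤ t → HasDerivAt V (-(a / b) * ∑ i, v t i ^ 2) t := by
    intro t ht
    have h1 : HasDerivAt (fun r => ∑ j, q r j * u j r)
        (∑ j, (qd j t * u j t + q t j * ud j t)) t :=
      HasDerivAt.fun_sum fun j _ => (dq j t ht).mul (du j t ht)
    have h2 : HasDerivAt (fun r => ∑ i, v r i ^ 2)
        (∑ i, (2 * v t i * (-a * v t i + b * s i t))) t :=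
      HasDerivAt.fun_sum fun i _ => by simpa using (dv i t ht).fun_pow 2
    refine ((h1.const_mul (-(1 / 2))).add (h2.const_mul (1 / (2 * b)))).congr_deriv ?_
    have h3 : ∑ j, q t j * ud j t = ∑ j, qd j t * u j t := by
      have e1 : ∑ j, q t j * ud j t = (q t : Fin n × Fin 2 → ℝ) ⬝ᵥ A.mulVec (fun j => qd j t) := rfl
      have e2 : ∑ j, qd j t * u j t = (fun j => qd j t) ⬝ᵥ A.mulVec (q t) := rfl
      rw [e1, e2, dotProduct_mulVec, ← mulVec_transpose, hsymm.eq, dotProduct_comm]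
    have h4 : ∑ j, qd j t * u j t = ∑ i, v t i * s i t := by
      rw [Fintype.sum_prod_type]
      refine Finset.sum_congr rfl fun i _ => ?_
      simp [Fin.sum_univ_two, hqd, hs]
      ring
    rw [Finset.sum_add_distrib, h3, h4, ← Finset.sum_add_distrib, Finset.mul_sum, Finset.mul_sum,
      Finset.mul_sum, ← Finset.sum_add_distrib]
    refine Finset.sum_congr rfl fun i _ => ?_
    field_simp
    ring
  have hVanti : AntitoneOn V (Set.Ici 0) := by
    refine antitoneOn_of_deriv_nonpos (convex_Ici 0)
      (fun t ht => (dV t ht).continuousAt.continuousWithinAt)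
      (fun t ht => ?_) (fun t ht => ?_)
    · rw [interior_Ici] at ht
      exact (dV t (le_of_lt ht)).differentiableAt.differentiableWithinAt
    · rw [interior_Ici] at ht
      rw [(dV t (le_of_lt ht)).deriv]
      have : 0 ≤ a / b * ∑ i, v t i ^ 2 := by positivity
      linarith
  have hquad : ∀ t, ∑ j, q t j * u j t ≤ 0 := fun t => hnsd (q t)
  have hkin : ∀ t, 0 ≤ 1 / (2 * b) * ∑ i, v t i ^ 2 := fun t => by positivity
  have hV0 : ∀ t, 0 ≤ V t := fun t => by
    have h1 := hquad t
    have h2 := hkin t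
    simp only [hV]
    linarith
  have hVle : ∀ t, 0 ≤ t → V t ≤ V 0 := fun t ht =>
    hVanti (Set.mem_Ici.2 le_rfl) (Set.mem_Ici.2 ht) ht
  obtain ⟨L, hL⟩ : ∃ L, Tendsto V atTop (nhds L) := by
    have hanti : Antitone (fun t => V (max t 0)) := fun x y hxy =>
      hVanti (Set.mem_Ici.2 (le_max_right _ _)) (Set.mem_Ici.2 (le_max_right _ _))
        (max_le_max_right 0 hxy)
    have := tendsto_atTop_ciInf hanti ⟨0, by rintro _ ⟨x, rfl⟩; exact hV0 _⟩
    refine ⟨_, this.congr' ?_⟩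
    filter_upwards [eventually_ge_atTop (0 : ℝ)] with t ht
    rw [max_eq_left ht]
  -- boundedness
  have bu : ∀ j, Bd (u j) := by
    intro j
    have hAjj : A j j ≤ 0 := by
      have := hnsd (Pi.single j 1)
      simpa using this
    refine ⟨(-A j j) * (2 * V 0) + 1, fun t ht => ?_⟩
    have h1 : (u j t) ^ 2 ≤ A j j * ∑ k, q t k * u k t := sq_le A hsymm hnsd (q t) j
    have h2 := hVle t ht
    have h3 := hkin t
    have h4 : -(2 * V 0) ≤ ∑ k, q t k * u k t := by
      simp only [hV] at h2 h3 ⊢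
      linarith
    have h5 : A j j * ∑ k, q t k * u k t ≤ (-A j j) * (2 * V 0) := by nlinarith
    rw [abs_le]
    constructor <;> nlinarith [sq_nonneg (u j t - 1), sq_nonneg (u j t + 1)]
  have bv : ∀ i, Bd (fun t => v t i) := by
    intro i
    refine ⟨2 * b * V 0 + 1, fun t ht => ?_⟩
    have h1 : v t i ^ 2 ≤ ∑ i, v t i ^ 2 :=
      Finset.single_le_sum (f := fun i => v t i ^ 2) (fun _ _ => sq_nonneg _) (Finset.mem_univ i)
    have h2 := hVle t ht
    have h3 := hquad t
    have h4 : 1 / (2 * b) * ∑ i, v t i ^ 2 ≤ V 0 := by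
      refine le_trans ?_ h2
      simp only [hV]
      linarith
    rw [one_div, inv_mul_le_iff₀ (by positivity)] at h4
    rw [abs_le]
    constructor <;> nlinarith [sq_nonneg (v t i - 1), sq_nonneg (v t i + 1)]
  have btrig : ∀ j : Fin n × Fin 2,
      Bd (fun t => if j.2 = 0 then Real.cos (δ t j.1) else Real.sin (δ t j.1)) := by
    intro j
    by_cases h : j.2 = 0
    · simpa [h] using Bd.cos _
    · simpa [h] using Bd.sin _
  have bud : ∀ j, Bd (ud j) := fun j =>
    Bd.sum _ fun k => (Bd.const _).mul ((bv k.1).mul (btrig k))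
  have bs : ∀ i, Bd (s i) := fun i =>
    ((Bd.cos _).mul (bu _)).add ((Bd.sin _).mul (bu _))
  have bp : ∀ i, Bd (p i) := fun i =>
    ((Bd.sin _).neg.mul (bu _)).add ((Bd.cos _).mul (bu _))
  have bω : ∀ i, Bd (fun t => ω t i) := fun i =>
    linear_bd hc (dω i) ((Bd.const d).mul (bp i))
  have bfac : ∀ i, Bd (fun t => l⁻¹ * (-Real.sin (θ t i) * Real.cos (δ t i) +
          Real.cos (θ t i) * Real.sin (δ t i))) := fun i =>
    (Bd.const _).mul (((Bd.sin _).neg.mul (Bd.cos _)).add ((Bd.cos _).mul (Bd.sin _)))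
  have hκeq : ∀ i, κ i = fun t => (l⁻¹ * (-Real.sin (θ t i) * Real.cos (δ t i) +
          Real.cos (θ t i) * Real.sin (δ t i))) * v t i := by
    intro i
    funext t
    simp only [hκ]
    ring
  have bκ : ∀ i, Bd (κ i) := fun i => by
    rw [hκeq]
    exact (bfac i).mul (bv i)
  have bdv : ∀ i, Bd (fun t => -a * v t i + b * s i t) := fun i =>
    ((Bd.const _).mul (bv i)).add ((Bd.const _).mul (bs i))
  have bds : ∀ i, Bd (fun t => (κ i t + ω t i) * p i t +
      (Real.cos (δ t i) * ud (i, 0) t + Real.sin (δ t i) * ud (i, 1) t)) := fun i =>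
    (((bκ i).add (bω i)).mul (bp i)).add
      (((Bd.cos _).mul (bud _)).add ((Bd.sin _).mul (bud _)))
  have bdp : ∀ i, Bd (fun t => -(κ i t + ω t i) * s i t +
      (-Real.sin (δ t i) * ud (i, 0) t + Real.cos (δ t i) * ud (i, 1) t)) := fun i =>
    (((bκ i).add (bω i)).neg.mul (bs i)).add
      (((Bd.sin _).neg.mul (bud _)).add ((Bd.cos _).mul (bud _)))
  have bdω : ∀ i, Bd (fun t => -c * ω t i + d * p i t) := fun i =>
    ((Bd.const _).mul (bω i)).add ((Bd.const _).mul (bp i))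
  -- convergence of v
  have tsum : Tendsto (fun t => -(a / b) * ∑ i, v t i ^ 2) atTop (nhds 0) := by
    refine barbalat (e := fun _ => 0) (g' := fun t => -(a / b) *
      ∑ i, (2 * v t i * (-a * v t i + b * s i t))) hL tendsto_const_nhds
      (fun t ht => by simpa using dV t ht) (fun t ht => ?_) ?_
    · exact (HasDerivAt.fun_sum fun i _ => by simpa using (dv i t ht).fun_pow 2).const_mul _
    · exact (Bd.const _).mul (Bd.sum _ fun i => ((Bd.const 2).mul (bv i)).mul (bdv i))
  have tv : ∀ i, Tendsto (fun t => v t i) atTop (nhds 0) := by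
    intro i
    have h1 : Tendsto (fun t => ∑ i, v t i ^ 2) atTop (nhds 0) := by
      have := tsum.const_mul (-(b / a))
      rw [mul_zero] at this
      refine this.congr fun t => ?_
      field_simp
    have h2 : Tendsto (fun t => v t i ^ 2) atTop (nhds 0) :=
      squeeze_zero (fun t => sq_nonneg _) (fun t =>
        Finset.single_le_sum (f := fun i => v t i ^ 2) (fun _ _ => sq_nonneg _)
          (Finset.mem_univ i)) h1
    exact (pow_eq_zero_iff_tendsto h2)
  have tκ : ∀ i, Tendsto (κ i) atTop (nhds 0) := fun i => by
    rw [hκeq]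
    exact (bfac i).mul_tendsto (tv i)
  have tud : ∀ j, Tendsto (ud j) atTop (nhds 0) := by
    intro j
    have : Tendsto (ud j) atTop (nhds (∑ k : Fin n × Fin 2, (0 : ℝ))) := by
      refine tendsto_finsetSum _ fun k _ => ?_
      refine (((Bd.const (A j k)).mul (btrig k)).mul_tendsto (tv k.1)).congr fun t => ?_
      simp only [hqd]
      ring
    simpa using this
  have ts : ∀ i, Tendsto (s i) atTop (nhds 0) := by
    intro i
    have h : Tendsto (fun t => b * s i t) atTop (nhds 0) := by
      refine barbalat (e := fun t => -a * v t i) (tv i)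
        ((Bd.const _).mul_tendsto (tv i))
        (fun t ht => (dv i t ht).congr_deriv (by ring))
        (fun t ht => (ds i t ht).const_mul b) ((Bd.const _).mul (bds i))
    have := h.const_mul b⁻¹
    rw [mul_zero] at this
    refine this.congr fun t => ?_
    field_simp
  have tωp : ∀ i, Tendsto (fun t => ω t i * p i t) atTop (nhds 0) := by
    intro i
    refine barbalat (e := fun t => p i t * κ i t +
      (Real.cos (δ t i) * ud (i, 0) t + Real.sin (δ t i) * ud (i, 1) t)) (ts i) ?_
        (fun t ht => (ds i t ht).congr_deriv (by ring))
        (fun t ht => (dω i t ht).mul (dp i t ht))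
        (((bdω i).mul (bp i)).add ((bω i).mul (bdp i)))
    simpa using ((bp i).mul_tendsto (tκ i)).add
      (((Bd.cos _).mul_tendsto (tud (i, 0))).add ((Bd.sin _).mul_tendsto (tud (i, 1))))
  have tp : ∀ i, Tendsto (p i) atTop (nhds 0) := by
    intro i
    have tdp : Tendsto (fun t => -(κ i t + ω t i) * s i t +
      (-Real.sin (δ t i) * ud (i, 0) t + Real.cos (δ t i) * ud (i, 1) t)) atTop (nhds 0) := by
      simpa using ((((bκ i).add (bω i)).neg).mul_tendsto (ts i)).add
        (((Bd.sin _).neg.mul_tendsto (tud (i, 0))).add ((Bd.cos _).mul_tendsto (tud (i, 1))))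
    have h : Tendsto (fun t => d * p i t ^ 2) atTop (nhds 0) := by
      refine barbalat (e := fun t => -c * (ω t i * p i t) + ω t i *
          (-(κ i t + ω t i) * s i t +
            (-Real.sin (δ t i) * ud (i, 0) t + Real.cos (δ t i) * ud (i, 1) t)))
        (g' := fun t => d * (2 * p i t * (-(κ i t + ω t i) * s i t +
            (-Real.sin (δ t i) * ud (i, 0) t + Real.cos (δ t i) * ud (i, 1) t))))
        (tωp i) ?_
        (fun t ht => ((dω i t ht).mul (dp i t ht)).congr_deriv (by ring))
        (fun t ht => ?_)
        ((Bd.const _).mul (((Bd.const _).mul (bp i)).mul (bdp i)))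
      · simpa using ((Bd.const (-c)).mul_tendsto (tωp i)).add ((bω i).mul_tendsto tdp)
      · refine HasDerivAt.const_mul d ?_
        simpa using (dp i t ht).fun_pow 2
    have := h.const_mul d⁻¹
    rw [mul_zero] at this
    refine pow_eq_zero_iff_tendsto (this.congr fun t => ?_)
    field_simp
  have tu : ∀ j, Tendsto (u j) atTop (nhds 0) := by
    rintro ⟨i, k⟩
    fin_cases k
    · have := ((Bd.cos (fun t => δ t i)).mul_tendsto (ts i)).add
        ((Bd.sin (fun t => δ t i)).neg.mul_tendsto (tp i))
      rw [add_zero] at this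
      refine this.congr fun t => ?_
      simp only [hs, hp, Fin.zero_eta]
      linear_combination (u (i, 0) t) * Real.sin_sq_add_cos_sq (δ t i)
    · have := ((Bd.sin (fun t => δ t i)).mul_tendsto (ts i)).add
        ((Bd.cos (fun t => δ t i)).mul_tendsto (tp i))
      rw [add_zero] at this
      refine this.congr fun t => ?_
      simp only [hs, hp, Fin.mk_one]
      linear_combination (u (i, 1) t) * Real.sin_sq_add_cos_sq (δ t i)
  exact ⟨infDist_tendsto A q tu, tendsto_pi_nhds.2 tv⟩
end

section
/- Let A be a real 2n×2n symmetric matrix, viewed as an n×n array of 2×2 blocks. Let q : ℝ → (ℝ²)ⁿ and θ : ℝ → ℝⁿ be continuously differentiable and suppose that for every agent i and all t, with hᵢ := (cos θᵢ, sin θᵢ) and uᵢ := (A q(t))ᵢ, the position dynamics q̇ᵢ = ⟨hᵢ, uᵢ⟩·hᵢ hold. Then the function V(t) := −(1/2)·q(t)ᵀ A q(t) satisfies, for all t, V̇(t) = −Σᵢ ⟨hᵢ(t), (A q(t))ᵢ⟩²; in particular V̇(t) ≤ 0. -/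
open Filter Matrix

theorem quad_hasDerivAt {ι : Type*} [Fintype ι] (A : Matrix ι ι ℝ) (hA : A.IsSymm)
    (x : ℝ → ι → ℝ) (v : ι → ℝ) (t : ℝ) (hx : ∀ k, HasDerivAt (fun s => x s k) (v k) t) :
    HasDerivAt (fun s => -(1 / 2) * (x s ⬝ᵥ A.mulVec (x s))) (-(v ⬝ᵥ A.mulVec (x t))) t := by
  have hm : ∀ k, HasDerivAt (fun s => A.mulVec (x s) k) (A.mulVec v k) t := by
    intro k
    simp only [Matrix.mulVec, dotProduct]
    exact HasDerivAt.fun_sum fun j _ => (hx j).const_mul (A k j)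
  have h : HasDerivAt (fun s => x s ⬝ᵥ A.mulVec (x s))
      (∑ k, (v k * A.mulVec (x t) k + x t k * A.mulVec v k)) t := by
    simp only [dotProduct]
    exact HasDerivAt.fun_sum fun k _ => (hx k).mul (hm k)
  refine (h.const_mul (-(1 / 2))).congr_deriv ?_
  have e : x t ⬝ᵥ A.mulVec v = v ⬝ᵥ A.mulVec (x t) := by
    rw [Matrix.dotProduct_mulVec, ← Matrix.mulVec_transpose, hA.eq, dotProduct_comm]
  have e2 : ∑ k, (v k * A.mulVec (x t) k + x t k * A.mulVec v k)
      = v ⬝ᵥ A.mulVec (x t) + x t ⬝ᵥ A.mulVec v := by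
    simp only [dotProduct, Finset.sum_add_distrib]
  rw [e2, e]
  ring

/-- For symmetric `A` and the unicycle position dynamics
`q̇ᵢ = ⟨hᵢ, uᵢ⟩ hᵢ` with `uᵢ = (A q)ᵢ`, the Lyapunov function `V = −(1/2) qᵀ A q`
satisfies `V̇(t) = −∑ᵢ ⟨hᵢ, (A q)ᵢ⟩²`; in particular `V̇(t) ≤ 0`. -/
theorem unicycle_lyapunov_derivative
    (n : ℕ) (A : Matrix (Fin n × Fin 2) (Fin n × Fin 2) ℝ) (hsymm : A.IsSymm)
    (q : ℝ → EuclideanSpace ℝ (Fin n × Fin 2)) (θ : ℝ → Fin n → ℝ)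
    (hq : ContDiff ℝ 1 q) (hθ : ContDiff ℝ 1 θ)
    (hdyn : ∀ t : ℝ, ∀ i : Fin n,
      HasDerivAt (fun s => q s (i, 0))
        ((Real.cos (θ t i) * A.mulVec (q t) (i, 0) +
          Real.sin (θ t i) * A.mulVec (q t) (i, 1)) * Real.cos (θ t i)) t ∧
      HasDerivAt (fun s => q s (i, 1))
        ((Real.cos (θ t i) * A.mulVec (q t) (i, 0) +
          Real.sin (θ t i) * A.mulVec (q t) (i, 1)) * Real.sin (θ t i)) t) :
    ∀ t : ℝ,
      HasDerivAt (fun s => -(1 / 2) * (q s ⬝ᵥ A.mulVec (q s)))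
        (-(∑ i : Fin n, (Real.cos (θ t i) * A.mulVec (q t) (i, 0) +
            Real.sin (θ t i) * A.mulVec (q t) (i, 1)) ^ 2)) t ∧
      deriv (fun s => -(1 / 2) * (q s ⬝ᵥ A.mulVec (q s))) t ≤ 0 := by
  intro t
  have key : HasDerivAt (fun s => -(1 / 2) * (q s ⬝ᵥ A.mulVec (q s)))
        (-(∑ i : Fin n, (Real.cos (θ t i) * A.mulVec (q t) (i, 0) +
            Real.sin (θ t i) * A.mulVec (q t) (i, 1)) ^ 2)) t := by
    refine (quad_hasDerivAt A hsymm (fun s => q s)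
      (fun k => (Real.cos (θ t k.1) * A.mulVec (q t) (k.1, 0) +
          Real.sin (θ t k.1) * A.mulVec (q t) (k.1, 1)) *
          ![Real.cos (θ t k.1), Real.sin (θ t k.1)] k.2) t ?_).congr_deriv ?_
    · rintro ⟨i, j⟩
      fin_cases j
      · exact (hdyn t i).1
      · exact (hdyn t i).2
    · rw [dotProduct, Fintype.sum_prod_type]
      congr 1
      refine Finset.sum_congr rfl fun i _ => ?_
      simp only [Fin.sum_univ_two, Matrix.cons_val_zero, Matrix.cons_val_one]
      ring
  refine ⟨key, ?_⟩
  rw [key.deriv]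
  exact neg_nonpos.mpr (Finset.sum_nonneg fun i _ => sq_nonneg _)
end
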